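/- Let k be a number field of degree n over ℚ. There exist a constant c > 0 and x₀ (depending on k) such that for all x ≥ x₀: the number of squarefree nonzero ideals 𝔡 of 𝓞_k with |𝔡| ≤ x whose number of distinct prime ideal divisors is congruent to n − 1 modulo 2, is at least c·x. -/

import Mathlib

open NumberField

open Filter Topology

theorem exists_squarefree_mul_sq {M : Type*} [CommMonoidWithZero M] [IsCancelMulZero M]
    [WfDvdMonoid M] {a : M} (ha : a ≠ 0) : ∃ d m : M, Squarefree d ∧ a = d * m ^ 2 := by
  induction a using WellFounded.induction (wellFounded_dvdNotUnit (α := M)) with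
  | _ a ih =>
    by_cases hs : Squarefree a
    · exact ⟨a, 1, hs, by simp⟩
    · simp only [Squarefree, not_forall] at hs
      obtain ⟨y, ⟨b, rfl⟩, hy⟩ := hs
      have hb : b ≠ 0 := right_ne_zero_of_mul ha
      obtain ⟨d, m, hd, hbm⟩ := ih b
        ⟨hb, y * y, fun h ↦ hy (isUnit_of_mul_isUnit_left h), mul_comm _ _⟩ hb
      refine ⟨d, y * m, hd, ?_⟩
      rw [hbm, mul_pow, sq y]
      exact mul_left_comm _ _ _

section Counting

variable (k : Type*) [Field k] [NumberField k]

/-- The nonzero ideals of norm at most `x`. -/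
def nonzeroIdealsLE (x : ℝ) : Set (Ideal (𝓞 k)) := {I | I ≠ ⊥ ∧ (Ideal.absNorm I : ℝ) ≤ x}

/-- The squarefree ideals of norm at most `x`. -/
def squarefreeIdealsLE (x : ℝ) : Set (Ideal (𝓞 k)) :=
  {I | Squarefree I ∧ (Ideal.absNorm I : ℝ) ≤ x}

variable {k}

theorem one_le_absNorm {I : Ideal (𝓞 k)} (hI : I ≠ ⊥) : (1 : ℝ) ≤ Ideal.absNorm I := by
  exact_mod_cast Nat.one_le_iff_ne_zero.mpr (by simpa [Ideal.absNorm_eq_zero_iff] using hI)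

theorem finite_nonzeroIdealsLE (x : ℝ) : (nonzeroIdealsLE k x).Finite :=
  (Ideal.finite_setOfPred_absNorm_le (S := 𝓞 k) ⌊x⌋₊).subset fun _ hI ↦ Nat.le_floor hI.2

theorem squarefreeIdealsLE_subset (x : ℝ) : squarefreeIdealsLE k x ⊆ nonzeroIdealsLE k x :=
  fun _ hI ↦ ⟨hI.1.ne_zero, hI.2⟩

theorem finite_squarefreeIdealsLE (x : ℝ) : (squarefreeIdealsLE k x).Finite :=
  (finite_nonzeroIdealsLE x).subset (squarefreeIdealsLE_subset x)

theorem squarefreeIdealsLE_mono {x y : ℝ} (h : x ≤ y) :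
    squarefreeIdealsLE k x ⊆ squarefreeIdealsLE k y :=
  fun _ hI ↦ ⟨hI.1, hI.2.trans h⟩

theorem nonzeroIdealsLE_eq_empty {x : ℝ} (h : x < 1) : nonzeroIdealsLE k x = ∅ :=
  Set.eq_empty_of_forall_notMem fun _ hI ↦ (h.trans_le (one_le_absNorm hI.1)).not_ge hI.2

variable (k)

theorem tendsto_ncard_nonzeroIdealsLE_div :
    Tendsto (fun x : ℝ ↦ ((nonzeroIdealsLE k x).ncard : ℝ) / x) atTop
      (𝓝 (dedekindZeta_residue k)) := by
  refine (Ideal.tendsto_norm_le_div_atTop₀ k).congr fun x ↦ ?_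
  congr 2
  rw [← Nat.card_coe_set_eq]
  refine Nat.card_congr ((Equiv.subtypeSubtypeEquivSubtypeInter
    (· ∈ nonZeroDivisors (Ideal (𝓞 k))) (fun I ↦ (Ideal.absNorm I : ℝ) ≤ x)).trans
    (Equiv.subtypeEquivRight fun I ↦ ?_))
  simp [nonzeroIdealsLE, mem_nonZeroDivisors_iff_ne_zero]

theorem exists_ncard_nonzeroIdealsLE_le :
    ∃ C : ℝ, 0 < C ∧ ∀ x : ℝ, 0 ≤ x → ((nonzeroIdealsLE k x).ncard : ℝ) ≤ C * x := by
  have hκ := dedekindZeta_residue_pos k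
  obtain ⟨s, hs⟩ := eventually_atTop.mp
    ((tendsto_ncard_nonzeroIdealsLE_div k).eventually_lt_const (lt_add_one _))
  set κ := dedekindZeta_residue k
  set N : ℝ := ((nonzeroIdealsLE k s).ncard : ℝ)
  refine ⟨κ + 1 + N, by positivity, fun x hx ↦ ?_⟩
  rcases lt_or_ge x 1 with h1 | h1
  · rw [nonzeroIdealsLE_eq_empty h1]
    simp only [Set.ncard_empty, Nat.cast_zero]
    positivity
  rcases le_total s x with h | h
  · have := (div_lt_iff₀ (by linarith)).mp (hs x h)
    have : 0 ≤ N * x := by positivity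
    nlinarith
  · have : ((nonzeroIdealsLE k x).ncard : ℝ) ≤ N := by
      refine Nat.cast_le.mpr (Set.ncard_le_ncard ?_ (finite_nonzeroIdealsLE s))
      exact fun I hI ↦ ⟨hI.1, hI.2.trans h⟩
    have : 0 ≤ N := by positivity
    nlinarith

theorem summable_card_absNorm_eq_div_sq :
    Summable fun n : ℕ ↦ ({I : Ideal (𝓞 k) | Ideal.absNorm I = n}.ncard : ℝ) / (n : ℝ) ^ 2 := by
  obtain ⟨C, hC, hle⟩ := exists_ncard_nonzeroIdealsLE_le k
  have hL : LSeriesSummable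
      (fun n ↦ (({I : Ideal (𝓞 k) | Ideal.absNorm I = n}.ncard : ℝ) : ℂ)) 2 := by
    refine LSeriesSummable_of_sum_norm_bigO_and_nonneg (r := 1) ?_ (fun _ ↦ by positivity)
      zero_le_one (by norm_num)
    refine Asymptotics.IsBigO.of_bound C (Eventually.of_forall fun n ↦ ?_)
    rw [Real.rpow_one, Real.norm_of_nonneg (by positivity), Real.norm_of_nonneg (by positivity)]
    refine le_trans ?_ (hle n (by positivity))
    rw [← Nat.cast_sum, Nat.cast_le]
    have hset : nonzeroIdealsLE k n = Ideal.absNorm ⁻¹' (Finset.Icc 1 n : Set ℕ) := by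
      ext I
      simp [nonzeroIdealsLE, Nat.one_le_iff_ne_zero, Ideal.absNorm_eq_zero_iff]
    rw [hset, ← Nat.card_coe_set_eq,
      Finset.card_preimage_eq_sum_card_image_eq
        (fun j _ ↦ Ideal.finite_setOfPred_absNorm_eq j)]
    exact le_of_eq rfl
  refine hL.norm.congr fun n ↦ ?_
  rcases eq_or_ne n 0 with rfl | hn
  · simp
  · simp [LSeries.term_of_ne_zero hn]

theorem summable_inv_absNorm_sq :
    Summable fun I : Ideal (𝓞 k) ↦ ((Ideal.absNorm I : ℝ) ^ 2)⁻¹ := by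
  classical
  have hsum := summable_card_absNorm_eq_div_sq k
  refine summable_of_sum_le (fun _ ↦ by positivity) (c := ∑' n : ℕ,
    ({I : Ideal (𝓞 k) | Ideal.absNorm I = n}.ncard : ℝ) / (n : ℝ) ^ 2) fun s ↦ ?_
  rw [← Finset.sum_fiberwise_of_maps_to
    (fun I hI ↦ Finset.mem_image_of_mem (fun I : Ideal (𝓞 k) ↦ Ideal.absNorm I) hI)]
  refine le_trans (Finset.sum_le_sum fun n _ ↦ ?_)
    (hsum.sum_le_tsum _ fun _ _ ↦ by positivity)
  have hcard : (s.filter fun I ↦ Ideal.absNorm I = n).card ≤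
      {I : Ideal (𝓞 k) | Ideal.absNorm I = n}.ncard := by
    rw [← Set.ncard_coe_finset]
    exact Set.ncard_le_ncard (fun I hI ↦ by simp_all) (Ideal.finite_setOfPred_absNorm_eq n)
  rw [Finset.sum_congr rfl fun I hI ↦ by rw [(Finset.mem_filter.mp hI).2], Finset.sum_const,
    nsmul_eq_mul, ← div_eq_mul_inv]
  gcongr

variable {k}

theorem ncard_nonzeroIdealsLE_le_sum (x : ℝ) :
    (nonzeroIdealsLE k x).ncard ≤ ∑ m ∈ (finite_nonzeroIdealsLE (k := k) x).toFinset,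
      (squarefreeIdealsLE k (x / (Ideal.absNorm m : ℝ) ^ 2)).ncard := by
  classical
  set F := (finite_nonzeroIdealsLE (k := k) x).toFinset with hF
  have hsub : nonzeroIdealsLE k x ⊆ ⋃ m ∈ F,
      (· * m ^ 2) '' squarefreeIdealsLE k (x / (Ideal.absNorm m : ℝ) ^ 2) := by
    rintro a ⟨ha, hax⟩
    obtain ⟨d, m, hd, rfl⟩ := exists_squarefree_mul_sq (Ideal.zero_eq_bot (R := 𝓞 k) ▸ ha)
    have hm : m ≠ ⊥ := by
      rintro rfl
      exact ha (by rw [← Ideal.zero_eq_bot, zero_pow two_ne_zero, mul_zero])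
    have h1 := one_le_absNorm hm
    have hd1 := one_le_absNorm (I := d) hd.ne_zero
    simp only [map_mul, map_pow, Nat.cast_mul, Nat.cast_pow] at hax
    refine Set.mem_iUnion₂.mpr ⟨m, ?_, d, ⟨hd, ?_⟩, rfl⟩
    · rw [hF, Set.Finite.mem_toFinset]
      exact ⟨hm, by nlinarith⟩
    · rwa [le_div_iff₀ (by positivity)]
  calc (nonzeroIdealsLE k x).ncard
      ≤ (⋃ m ∈ F, (· * m ^ 2) '' squarefreeIdealsLE k (x / (Ideal.absNorm m : ℝ) ^ 2)).ncard :=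
        Set.ncard_le_ncard hsub
          (F.finite_toSet.biUnion fun m _ ↦ (finite_squarefreeIdealsLE _).image _)
    _ ≤ ∑ m ∈ F, ((· * m ^ 2) ''
          squarefreeIdealsLE k (x / (Ideal.absNorm m : ℝ) ^ 2)).ncard :=
        Finset.set_ncard_biUnion_le _ _
    _ ≤ _ := Finset.sum_le_sum fun m _ ↦ Set.ncard_image_le (finite_squarefreeIdealsLE _)

variable (k)

theorem exists_le_ncard_squarefreeIdealsLE :
    ∃ c : ℝ, 0 < c ∧ ∃ x₀ : ℝ, ∀ x : ℝ, x₀ ≤ x →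
      c * x ≤ (squarefreeIdealsLE k x).ncard := by
  classical
  have hκ := dedekindZeta_residue_pos k
  obtain ⟨s, hs⟩ := eventually_atTop.mp
    ((tendsto_ncard_nonzeroIdealsLE_div k).eventually_const_lt (half_lt_self hκ))
  obtain ⟨C, hC, hle⟩ := exists_ncard_nonzeroIdealsLE_le k
  set κ := dedekindZeta_residue k
  obtain ⟨S, hS⟩ := summable_iff_vanishing_norm.mp (summable_inv_absNorm_sq k) (κ / (4 * C))
    (by positivity)
  refine ⟨κ / (4 * (S.card + 1)), by positivity, max s 1, fun x hx ↦ ?_⟩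
  have hx1 : 1 ≤ x := (le_max_right _ _).trans hx
  have hlow := (lt_div_iff₀ (by linarith)).mp (hs x ((le_max_left _ _).trans hx))
  set F := (finite_nonzeroIdealsLE (k := k) x).toFinset with hF
  have hsplit : ((nonzeroIdealsLE k x).ncard : ℝ) ≤ ∑ m ∈ F,
      ((squarefreeIdealsLE k (x / (Ideal.absNorm m : ℝ) ^ 2)).ncard : ℝ) := by
    exact_mod_cast ncard_nonzeroIdealsLE_le_sum x
  rw [← Finset.sum_inter_add_sum_sdiff F S] at hsplit
  have hsmall : ∑ m ∈ F ∩ S,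
      ((squarefreeIdealsLE k (x / (Ideal.absNorm m : ℝ) ^ 2)).ncard : ℝ) ≤
        S.card * (squarefreeIdealsLE k x).ncard := by
    have hterm : ∀ m ∈ F ∩ S,
        ((squarefreeIdealsLE k (x / (Ideal.absNorm m : ℝ) ^ 2)).ncard : ℝ) ≤
          (squarefreeIdealsLE k x).ncard := fun m hm ↦ by
      rw [Finset.mem_inter, hF, Set.Finite.mem_toFinset] at hm
      have h1 := one_le_absNorm hm.1.1
      exact_mod_cast Set.ncard_le_ncard
        (squarefreeIdealsLE_mono (div_le_self (by linarith) (one_le_pow₀ h1)))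
        (finite_squarefreeIdealsLE x)
    refine (Finset.sum_le_card_nsmul _ _ _ hterm).trans ?_
    rw [nsmul_eq_mul]
    gcongr
    exact Finset.inter_subset_right
  have hlarge : ∑ m ∈ F \ S,
      ((squarefreeIdealsLE k (x / (Ideal.absNorm m : ℝ) ^ 2)).ncard : ℝ) ≤ κ / 4 * x := by
    have hterm : ∀ m ∈ F \ S,
        ((squarefreeIdealsLE k (x / (Ideal.absNorm m : ℝ) ^ 2)).ncard : ℝ) ≤
          C * x * ((Ideal.absNorm m : ℝ) ^ 2)⁻¹ := fun m _ ↦ by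
      rw [mul_assoc, ← div_eq_mul_inv]
      refine le_trans ?_ (hle _ (by positivity))
      exact_mod_cast Set.ncard_le_ncard (squarefreeIdealsLE_subset _) (finite_nonzeroIdealsLE _)
    refine (Finset.sum_le_sum hterm).trans ?_
    rw [← Finset.mul_sum]
    have htail := (le_abs_self _).trans (hS (F \ S) Finset.sdiff_disjoint).le
    calc C * x * ∑ m ∈ F \ S, ((Ideal.absNorm m : ℝ) ^ 2)⁻¹ ≤ C * x * (κ / (4 * C)) := by gcongr
      _ = κ / 4 * x := by field_simp
  have hT : (0 : ℝ) ≤ (squarefreeIdealsLE k x).ncard := by positivity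
  rw [div_mul_eq_mul_div, div_le_iff₀ (by positivity)]
  nlinarith

end Counting

section Parity

variable {R : Type*} [CommRing R] [IsDedekindDomain R]

theorem ncard_primeDivisors_mul {I 𝔭 : Ideal R} (hI : I ≠ ⊥) (h𝔭 : Prime 𝔭) (hdvd : ¬ 𝔭 ∣ I) :
    {P : Ideal R | P ≠ ⊥ ∧ P.IsPrime ∧ P ∣ I * 𝔭}.ncard =
      {P : Ideal R | P ≠ ⊥ ∧ P.IsPrime ∧ P ∣ I}.ncard + 1 := by
  have hfin : {P : Ideal R | P ≠ ⊥ ∧ P.IsPrime ∧ P ∣ I}.Finite := by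
    have : Finite {P : Ideal R // P ∣ I} :=
      (UniqueFactorizationMonoid.fintypeSubtypeDvd I hI).finite
    exact (Set.finite_coe_iff (s := {P : Ideal R | P ∣ I}).mp this).subset fun P hP ↦ hP.2.2
  rw [← Set.ncard_insert_of_notMem (a := 𝔭) (fun h ↦ hdvd h.2.2) hfin]
  congr 1
  ext P
  simp only [Set.mem_ofPred_eq, Set.mem_insert_iff]
  constructor
  · rintro ⟨h0, hP, hd⟩
    rcases (Ideal.prime_of_isPrime h0 hP).dvd_or_dvd hd with h | h
    · exact .inr ⟨h0, hP, h⟩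
    · exact .inl (associated_iff_eq.mp
        ((Ideal.prime_of_isPrime h0 hP).associated_of_dvd h𝔭 h))
  · rintro (rfl | ⟨h0, hP, hd⟩)
    · exact ⟨h𝔭.ne_zero, Ideal.isPrime_of_prime h𝔭, dvd_mul_left _ _⟩
    · exact ⟨h0, hP, hd.mul_right _⟩

end Parity

theorem ncard_squarefreeIdealsLE_le_three_mul {k : Type*} [Field k] [NumberField k]
    {𝔭 : Ideal (𝓞 k)} (h𝔭 : Prime 𝔭) (e : ℕ) {x : ℝ} (hx : 0 ≤ x) :
    (squarefreeIdealsLE k x).ncard ≤ 3 *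
      {𝔡 : Ideal (𝓞 k) | 𝔡 ≠ ⊥ ∧ Squarefree 𝔡 ∧
        (Ideal.absNorm 𝔡 : ℝ) ≤ Ideal.absNorm 𝔭 * x ∧
        {P : Ideal (𝓞 k) | P ≠ ⊥ ∧ P.IsPrime ∧ P ∣ 𝔡}.ncard % 2 = e % 2}.ncard := by
  set A := {𝔡 : Ideal (𝓞 k) | 𝔡 ≠ ⊥ ∧ Squarefree 𝔡 ∧
        (Ideal.absNorm 𝔡 : ℝ) ≤ Ideal.absNorm 𝔭 * x ∧
        {P : Ideal (𝓞 k) | P ≠ ⊥ ∧ P.IsPrime ∧ P ∣ 𝔡}.ncard % 2 = e % 2} with hA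
  have hq : (1 : ℝ) ≤ Ideal.absNorm 𝔭 := one_le_absNorm h𝔭.ne_zero
  have hAfin : A.Finite := (finite_nonzeroIdealsLE _).subset fun 𝔡 h ↦ ⟨h.1, h.2.2.1⟩
  have hinj : Function.Injective (· * 𝔭) := mul_left_injective₀ h𝔭.ne_zero
  -- squarefree ideals of the wrong parity become good after adding or removing the factor `𝔭`
  have hsub : squarefreeIdealsLE k x ⊆ A ∪ ((· * 𝔭) ⁻¹' A ∪ (· * 𝔭) '' A) := by
    rintro 𝔡 ⟨hsq, hle⟩
    by_cases hpar : {P : Ideal (𝓞 k) | P ≠ ⊥ ∧ P.IsPrime ∧ P ∣ 𝔡}.ncard % 2 = e % 2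
    · exact .inl ⟨hsq.ne_zero, hsq, by nlinarith, hpar⟩
    refine .inr ?_
    by_cases hdvd : 𝔭 ∣ 𝔡
    · obtain ⟨I, rfl⟩ := hdvd
      rw [mul_comm 𝔭 I] at *
      have hI : ¬ 𝔭 ∣ I := fun h ↦ h𝔭.not_isUnit (hsq 𝔭 (mul_dvd_mul_right h 𝔭))
      have hIsq : Squarefree I := hsq.of_mul_left
      rw [ncard_primeDivisors_mul hIsq.ne_zero h𝔭 hI] at hpar
      have hI1 := one_le_absNorm (I := I) hIsq.ne_zero
      rw [map_mul, Nat.cast_mul] at hle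
      exact .inr ⟨I, ⟨hIsq.ne_zero, hIsq, by nlinarith, by omega⟩, rfl⟩
    · refine .inl ⟨mul_ne_zero hsq.ne_zero h𝔭.ne_zero, ?_, ?_, ?_⟩
      · exact squarefree_mul_iff.mpr
          ⟨(h𝔭.irreducible.isRelPrime_iff_not_dvd.mpr hdvd).symm, hsq, h𝔭.squarefree⟩
      · rw [map_mul, Nat.cast_mul, mul_comm]
        gcongr
      · rw [ncard_primeDivisors_mul hsq.ne_zero h𝔭 hdvd]
        omega
  have hpre : ((· * 𝔭) ⁻¹' A).Finite := hAfin.preimage hinj.injOn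
  have h1 := Set.ncard_le_ncard hsub (hAfin.union (hpre.union (hAfin.image _)))
  have h2 := Set.ncard_union_le A ((· * 𝔭) ⁻¹' A ∪ (· * 𝔭) '' A)
  have h3 := Set.ncard_union_le ((· * 𝔭) ⁻¹' A) ((· * 𝔭) '' A)
  have h4 : ((· * 𝔭) '' A).ncard ≤ A.ncard := Set.ncard_image_le hAfin
  have h5 : ((· * 𝔭) ⁻¹' A).ncard ≤ A.ncard :=
    Set.ncard_le_ncard_of_injOn (· * 𝔭) (fun _ h ↦ h) hinj.injOn hAfin
  omega

/-- Lower bound of order `x` for the number of squarefree ideals `𝔡` of `𝓞 k` with `|𝔡| ≤ x`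
whose number of distinct prime divisors is congruent to `n − 1 (mod 2)`, where `n = [k : ℚ]`. -/
theorem stmt_13 (k : Type*) [Field k] [NumberField k] :
    ∃ c : ℝ, 0 < c ∧ ∃ x₀ : ℝ, ∀ x : ℝ, x₀ ≤ x →
      c * x ≤
        ({𝔡 : Ideal (𝓞 k) | 𝔡 ≠ ⊥ ∧ Squarefree 𝔡 ∧ (Ideal.absNorm 𝔡 : ℝ) ≤ x ∧
            {P : Ideal (𝓞 k) | P ≠ ⊥ ∧ P.IsPrime ∧ P ∣ 𝔡}.ncard % 2 =
              (Module.finrank ℚ k - 1) % 2}.ncard : ℝ) := by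
  obtain ⟨c, hc, x₀, h⟩ := exists_le_ncard_squarefreeIdealsLE k
  obtain ⟨𝔭, h0, hprime⟩ := Ring.not_isField_iff_exists_prime.mp (RingOfIntegers.not_isField k)
  have h𝔭 : Prime 𝔭 := Ideal.prime_of_isPrime h0 hprime
  have hq : (1 : ℝ) ≤ Ideal.absNorm 𝔭 := one_le_absNorm h0
  set q : ℝ := (Ideal.absNorm 𝔭 : ℝ) with hqdef
  refine ⟨c / (3 * q), by positivity, q * max x₀ 0, fun x hx ↦ ?_⟩
  have hxq : max x₀ 0 ≤ x / q := by rwa [le_div_iff₀ (by positivity), mul_comm]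
  have h1 := h _ ((le_max_left _ _).trans hxq)
  have h2 := Nat.cast_le (α := ℝ).mpr (ncard_squarefreeIdealsLE_le_three_mul h𝔭
    (Module.finrank ℚ k - 1) ((le_max_right _ _).trans hxq))
  rw [Nat.cast_mul, Nat.cast_ofNat, ← hqdef, mul_div_cancel₀ x (by positivity : q ≠ 0)] at h2
  have h3 : c / (3 * q) * x = c * (x / q) / 3 := by field_simp
  linarith
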